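/- arXiv:1201.3898 — 2 statements merged into one kernel-verified Lean document; each statement's English description precedes it below -/
import Mathlib

section
/- Homotopy-initial P-algebras are unique up to weak equivalence: if (W, sW) and (W', sW') are both homotopy-initial P-algebras for the same polynomial functor P, then there exists a function f : W → W' which is a weak equivalence and satisfies f ∘ sW = sW' ∘ Pmap f. -/
universe u

/-- A type is contractible if the type `Σ x : A, ∀ y : A, x = y` is inhabited. -/
def IsContr (A : Sort*) : Prop := ∃ x : A, ∀ y : A, x = y

/-- The homotopy fiber of `f` at `y`. -/
def hfiber {A B : Type*} (f : A → B) (y : B) : Type _ := Σ' x : A, f x = y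

/-- The action of the polynomial functor `P X = Σ a : A, B a → X` on a map `f : X → Y`. -/
def Pmap {A : Type*} {B : A → Type*} {X Y : Type*} (f : X → Y) :
    (Σ a : A, B a → X) → Σ a : A, B a → Y :=
  fun p => ⟨p.1, f ∘ p.2⟩

/-- Weak homomorphisms of algebras for a polynomial functor compose. -/
theorem comp_weakHom {A : Type*} {B : A → Type*} {X Y Z : Type*}
    {sX : (Σ a : A, B a → X) → X} {sY : (Σ a : A, B a → Y) → Y} {sZ : (Σ a : A, B a → Z) → Z}
    {f : X → Y} {g : Y → Z} (hf : f ∘ sX = sY ∘ Pmap f) (hg : g ∘ sY = sZ ∘ Pmap g) :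
    (g ∘ f) ∘ sX = sZ ∘ Pmap (g ∘ f) := by
  calc (g ∘ f) ∘ sX = g ∘ sY ∘ Pmap f := congrArg (g ∘ ·) hf
    _ = sZ ∘ Pmap (g ∘ f) := congrArg (· ∘ Pmap f) hg

/-- If the weak endomorphisms of an algebra form a contractible type, each of them is the
identity. -/
theorem weakHom_eq_id {A : Type*} {B : A → Type*} {X : Type*} {sX : (Σ a : A, B a → X) → X}
    (hX : IsContr (Σ' f : X → X, f ∘ sX = sX ∘ Pmap f))
    {f : X → X} (hf : f ∘ sX = sX ∘ Pmap f) : f = id := by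
  obtain ⟨c, hc⟩ := hX
  exact congrArg PSigma.fst ((hc ⟨f, hf⟩).symm.trans (hc ⟨id, rfl⟩))

/-- A function with a two-sided inverse is a weak equivalence. -/
theorem isContr_hfiber_of_inverse {X Y : Type*} {f : X → Y} {g : Y → X}
    (hgf : g ∘ f = id) (hfg : f ∘ g = id) (y : Y) : IsContr (hfiber f y) := by
  refine ⟨⟨g y, congrFun hfg y⟩, ?_⟩
  rintro ⟨x, rfl⟩
  exact PSigma.ext (congrFun hgf x) (proof_irrel_heq _ _)

theorem hinitial_unique_up_to_weq {A : Type u} {B : A → Type u}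
    {W W' : Type u}
    (sW : (Σ a : A, B a → W) → W) (sW' : (Σ a : A, B a → W') → W')
    (hinit : ∀ (D : Type u) (sD : (Σ a : A, B a → D) → D),
      IsContr (Σ' f : W → D, f ∘ sW = sD ∘ Pmap f))
    (hinit' : ∀ (D : Type u) (sD : (Σ a : A, B a → D) → D),
      IsContr (Σ' f : W' → D, f ∘ sW' = sD ∘ Pmap f)) :
    ∃ f : W → W', (∀ y : W', IsContr (hfiber f y)) ∧ f ∘ sW = sW' ∘ Pmap f := by
  obtain ⟨⟨f, hf⟩, -⟩ := hinit W' sW'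
  obtain ⟨⟨g, hg⟩, -⟩ := hinit' W sW
  exact ⟨f, isContr_hfiber_of_inverse (weakHom_eq_id (hinit W sW) (comp_weakHom hf hg))
    (weakHom_eq_id (hinit' W' sW') (comp_weakHom hg hf)), hf⟩
end

section
/- If a P-algebra (W, sW) is strictly initial, i.e., for every type C with structure map sC : (Σ a : A, B a → C) → C there exists a unique f : W → C with f ∘ sW = sC ∘ Pmap f, then W satisfies the dependent W-elimination rule with propositional computation rule: for every type family C : W → Type and function c : ∀ (a : A) (u : B a → W), (∀ y : B a, C (u y)) → C (sW ⟨a, u⟩), there exists r : ∀ w : W, C w with ∀ (a : A) (u : B a → W), r (sW ⟨a, u⟩) = c a u (fun y => r (u y)). -/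
universe u

theorem w_elim_of_strict_initial {A : Type u} {B : A → Type u} {W : Type u}
    (sW : (Σ a : A, B a → W) → W)
    (hinit : ∀ (C : Type u) (sC : (Σ a : A, B a → C) → C),
      ∃! f : W → C, f ∘ sW = sC ∘ Pmap f)
    (C : W → Type u)
    (c : ∀ (a : A) (u : B a → W), (∀ y : B a, C (u y)) → C (sW ⟨a, u⟩)) :
    ∃ r : ∀ w : W, C w,
      ∀ (a : A) (u : B a → W), r (sW ⟨a, u⟩) = c a u (fun y => r (u y)) := by
  obtain ⟨f, hf, -⟩ := hinit (Σ w, C w) fun p =>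
    ⟨sW ⟨p.1, fun y => (p.2 y).1⟩, c p.1 (fun y => (p.2 y).1) fun y => (p.2 y).2⟩
  have hfst : Sigma.fst ∘ f = id := by
    refine (hinit W sW).unique ?_ rfl
    funext p
    exact congrArg Sigma.fst (congrFun hf p)
  obtain ⟨r, rfl⟩ : ∃ r : ∀ w, C w, f = fun w => ⟨w, r w⟩ :=
    ⟨fun w => cast (congrArg C (congrFun hfst w)) (f w).2,
      funext fun w => Sigma.ext (congrFun hfst w) (cast_heq _ _).symm⟩
  exact ⟨r, fun a u => eq_of_heq (Sigma.ext_iff.mp (congrFun hf ⟨a, u⟩)).2⟩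
end
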